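/- Let d ≥ 1, let Ω ⊂ ℝ^d be a compact set with vol(Ω) > 0, and let V ⊆ ℝ^d be an open set containing Ω. Then there exist a > 0 and, for each λ ∈ {0,1}^d, a finite set Γ_λ ⊆ a·λ + 2a·ℤ^d, such that, writing Q_λ for the family of open cubes {v + (−2a/3, 2a/3)^d : v ∈ Γ_λ}: (1) within each family Q_λ the cubes are pairwise disjoint and each cube is contained in V; (2) Ω ⊆ ⋃_{λ ∈ {0,1}^d} ⋃_{Q ∈ Q_λ} Q; and (3) for each λ ∈ {0,1}^d, vol(⋃_{Q ∈ Q_λ} Q) ≤ 2 · vol(Ω). -/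

import Mathlib

open MeasureTheory

/-- The open cube of side `4a/3` centered at the lattice point `a·λ + 2a·m`. -/
def gridCube (d : ℕ) (a : ℝ) (lam : Fin d → Fin 2) (m : Fin d → ℤ) :
    Set (Fin d → ℝ) :=
  {x | ∀ i, |x i - (a * ((lam i : ℕ) : ℝ) + 2 * a * (m i : ℝ))| < 2 * a / 3}

theorem dist_lt_of_mem_gridCube {d : ℕ} {a : ℝ} {lam : Fin d → Fin 2} {m : Fin d → ℤ}
    {x y : Fin d → ℝ} (ha : 0 < a) (hx : x ∈ gridCube d a lam m)
    (hy : y ∈ gridCube d a lam m) : dist x y < 4 * a / 3 := by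
  rw [dist_pi_lt_iff (by positivity)]
  intro i
  have hxi := abs_lt.1 (hx i)
  have hyi := abs_lt.1 (hy i)
  rw [Real.dist_eq, abs_lt]
  constructor <;> linarith

theorem gridCube_disjoint {d : ℕ} {a : ℝ} (ha : 0 < a) (lam : Fin d → Fin 2)
    {m m' : Fin d → ℤ} (hne : m ≠ m') :
    Disjoint (gridCube d a lam m) (gridCube d a lam m') := by
  rw [Set.disjoint_left]
  intro x hx hx'
  apply hne
  ext i
  have h := abs_lt.1 (hx i)
  have h' := abs_lt.1 (hx' i)
  have h₁ : (m i : ℝ) < m' i + 1 := by nlinarith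
  have h₂ : (m' i : ℝ) < m i + 1 := by nlinarith
  have h₁' : m i < m' i + 1 := by exact_mod_cast h₁
  have h₂' : m' i < m i + 1 := by exact_mod_cast h₂
  omega

theorem exists_mem_gridCube {d : ℕ} {a : ℝ} (ha : 0 < a) (x : Fin d → ℝ) :
    ∃ lam m, x ∈ gridCube d a lam m := by
  have key : ∀ i, ∃ (l : Fin 2) (n : ℤ),
      |x i - (a * ((l : ℕ) : ℝ) + 2 * a * (n : ℝ))| < 2 * a / 3 := by
    intro i
    have hround : |x i - a * (round (x i / a) : ℝ)| < 2 * a / 3 := by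
      have h := abs_sub_round (x i / a)
      have hx : x i - a * (round (x i / a) : ℝ) = a * (x i / a - round (x i / a)) := by
        field_simp
      rw [hx, abs_mul, abs_of_pos ha]
      nlinarith
    rcases Int.even_or_odd' (round (x i / a)) with ⟨n, hn | hn⟩ <;> rw [hn] at hround
    · refine ⟨0, n, ?_⟩
      convert hround using 2
      push_cast
      simp
      ring
    · refine ⟨1, n, ?_⟩
      convert hround using 2
      push_cast
      simp
      ring
  choose l n h using key
  exact ⟨l, n, h⟩

theorem finite_setOf_gridCube_inter_nonempty {d : ℕ} {a : ℝ} (ha : 0 < a)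
    (lam : Fin d → Fin 2) {s : Set (Fin d → ℝ)} (hs : Bornology.IsBounded s) :
    {m : Fin d → ℤ | (gridCube d a lam m ∩ s).Nonempty}.Finite := by
  obtain ⟨R, hR⟩ := hs.exists_norm_le
  obtain ⟨N, hN⟩ := exists_nat_gt ((R + 2 * a) / (2 * a))
  rw [div_lt_iff₀ (by positivity)] at hN
  refine (Set.finite_Icc (fun _ : Fin d => -(N : ℤ)) (fun _ => (N : ℤ))).subset ?_
  rintro m ⟨x, hx, hxs⟩
  have bound : ∀ i, -(N : ℤ) ≤ m i ∧ m i ≤ N := by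
    intro i
    have hxi := abs_lt.1 (hx i)
    have hRi := abs_le.1 ((norm_le_pi_norm x i).trans (hR x hxs))
    have hl : (((lam i : ℕ) : ℝ)) ≤ 1 := by
      exact_mod_cast Nat.le_of_lt_succ (lam i).isLt
    have hl₀ : (0 : ℝ) ≤ ((lam i : ℕ) : ℝ) := Nat.cast_nonneg _
    have h₁ : -(N : ℝ) ≤ m i := by nlinarith
    have h₂ : (m i : ℝ) ≤ N := by nlinarith
    exact ⟨by exact_mod_cast h₁, by exact_mod_cast h₂⟩
  exact ⟨fun i => (bound i).1, fun i => (bound i).2⟩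

/-- **Covering by `2^d` families of disjoint cubes of controlled volume.** Given a
compact `Ω ⊂ ℝ^d` of positive volume and an open `V ⊇ Ω`, there exist `a > 0`
and, for each `λ ∈ {0,1}^d`, a finite set `Γ_λ` of lattice points of
`a·λ + 2a·ℤ^d` such that: within each family the cubes are pairwise disjoint and
contained in `V`; the cubes of all families together cover `Ω`; and each family
has total volume at most `2·vol(Ω)`. -/
theorem cube_cover_of_compact (d : ℕ) (hd : 1 ≤ d)
    (Ω V : Set (Fin d → ℝ))
    (hΩ : IsCompact Ω) (hΩpos : 0 < volume Ω)
    (hV : IsOpen V) (hΩV : Ω ⊆ V) :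
    ∃ a : ℝ, 0 < a ∧
      ∃ Γ : (Fin d → Fin 2) → Finset (Fin d → ℤ),
        (∀ lam, ∀ m ∈ Γ lam, ∀ m' ∈ Γ lam, m ≠ m' →
          Disjoint (gridCube d a lam m) (gridCube d a lam m')) ∧
        (∀ lam, ∀ m ∈ Γ lam, gridCube d a lam m ⊆ V) ∧
        (Ω ⊆ ⋃ lam : Fin d → Fin 2, ⋃ m ∈ Γ lam, gridCube d a lam m) ∧
        (∀ lam, volume (⋃ m ∈ Γ lam, gridCube d a lam m) ≤ 2 * volume Ω) := by
  have hfin : volume Ω ≠ ⊤ := hΩ.measure_lt_top.ne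
  obtain ⟨U, hΩU, hU, hUvol⟩ := Ω.exists_isOpen_lt_of_lt (2 * volume Ω) (by
    rw [two_mul]
    exact ENNReal.lt_add_right hfin hΩpos.ne')
  obtain ⟨δ, hδ, hthick⟩ := hΩ.exists_thickening_subset_open (hU.inter hV)
    (Set.subset_inter hΩU hΩV)
  have ha : 0 < δ / 2 := half_pos hδ
  have hfinite := fun lam =>
    finite_setOf_gridCube_inter_nonempty ha lam hΩ.isBounded
  have hsub : ∀ lam, ∀ m ∈ (hfinite lam).toFinset, gridCube d (δ / 2) lam m ⊆ U ∩ V := by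
    intro lam m hm x hx
    obtain ⟨y, hy, hyΩ⟩ := (hfinite lam).mem_toFinset.1 hm
    refine hthick (Metric.mem_thickening_iff.2 ⟨y, hyΩ, ?_⟩)
    linarith [dist_lt_of_mem_gridCube ha hx hy]
  refine ⟨δ / 2, ha, fun lam => (hfinite lam).toFinset,
    fun lam m _ m' _ hne => gridCube_disjoint ha lam hne,
    fun lam m hm => (hsub lam m hm).trans Set.inter_subset_right, fun x hx => ?_,
    fun lam => ?_⟩
  · obtain ⟨lam, m, hm⟩ := exists_mem_gridCube ha x
    simp only [Set.mem_iUnion]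
    exact ⟨lam, m, (hfinite lam).mem_toFinset.2 ⟨x, hm, hx⟩, hm⟩
  · refine (measure_mono (Set.iUnion₂_subset fun m hm => ?_)).trans hUvol.le
    exact (hsub lam m hm).trans Set.inter_subset_left
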